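/- There exists an absolute constant K > 0 with the following property. Let G be a finite simple graph with no isolated vertices and m ≥ 2 edges, let 0 < α ≤ 1/3, let p° : V → ℝ≥0 with ∑_v p°(v) = 1, and set p* = PR(α, p°). If 0 < γ < 1 and there exists a vertex u with p*(u)/d(u) ≤ (1−γ)/(2m), then there exists a nonempty set T ⊆ V with vol(T) ≤ m and Φ(T) ≤ K·sqrt(α·log₂ m / γ). -/

import Mathlib

open scoped Classical
open Finset

noncomputable section

variable {V : Type*} [Fintype V]

/-- The set of edges of `G` with exactly one endpoint in `S`. -/
def bdry (G : SimpleGraph V) (S : Finset V) : Finset (Sym2 V) :=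
  G.edgeFinset.filter fun e => ∃ u v, u ∈ S ∧ v ∉ S ∧ e = s(u, v)

/-- The volume of `S`: the sum of the degrees of the vertices of `S`. -/
def vol (G : SimpleGraph V) (S : Finset V) : ℕ := ∑ v ∈ S, G.degree v

/-- The conductance `Φ(S) = |∂S| / min(vol S, 2m − vol S)`. -/
def conduct (G : SimpleGraph V) (S : Finset V) : ℝ :=
  ((bdry G S).card : ℝ) /
    ((min (vol G S) (2 * G.edgeFinset.card - vol G S) : ℕ) : ℝ)

/-- The lazy random walk operator: `(W q)(v) = q(v)/2 + ∑_{u ~ v} q(u)/(2 d(u))`. -/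
def lazyWalk (G : SimpleGraph V) (q : V → ℝ) : V → ℝ := fun v =>
  q v / 2 + ∑ u ∈ G.neighborFinset v, q u / (2 * (G.degree u : ℝ))

/-- The PageRank limit distribution `PR(α, p°) = α ∑_{k≥0} (1−α)^k (p° W^k)`. -/
def PR (G : SimpleGraph V) (α : ℝ) (p0 : V → ℝ) : V → ℝ := fun v =>
  α * ∑' k : ℕ, (1 - α) ^ k * (lazyWalk G)^[k] p0 v

/-- The ordered pairs of adjacent vertices leading from `S` to its complement. -/
def crossing (G : SimpleGraph V) (S : Finset V) : Finset (V × V) :=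
  (S ×ˢ Sᶜ).filter fun x => G.Adj x.1 x.2

/-- The sublevel set of `f` at height `t`. -/
def sublevel (f : V → ℝ) (t : ℝ) : Finset V := univ.filter fun v => f v ≤ t

lemma card_bdry_le_card_crossing (G : SimpleGraph V) (S : Finset V) :
    (bdry G S).card ≤ (crossing G S).card := by
  have h : bdry G S ⊆ (crossing G S).image fun x => s(x.1, x.2) := by
    intro e he
    simp only [bdry, mem_filter] at he
    obtain ⟨he, u, v, hu, hv, rfl⟩ := he
    refine mem_image.2 ⟨(u, v), ?_, rfl⟩
    simpa [crossing, hu, hv] using he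
  exact (card_le_card h).trans card_image_le

lemma bdry_compl (G : SimpleGraph V) (S : Finset V) : bdry G Sᶜ = bdry G S := by
  ext e
  simp only [bdry, mem_filter, mem_compl, not_not]
  refine and_congr_right fun _ => ⟨?_, ?_⟩ <;>
  · rintro ⟨u, v, hu, hv, rfl⟩
    exact ⟨v, u, hv, hu, Sym2.eq_swap⟩

lemma card_crossing_le_vol (G : SimpleGraph V) (S : Finset V) :
    (crossing G S).card ≤ vol G S := by
  have h : crossing G S ⊆ S.biUnion fun v => (G.neighborFinset v).image fun w => (v, w) := by
    rintro ⟨v, w⟩ hx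
    simp only [crossing, mem_filter, mem_product] at hx
    simpa using ⟨hx.1.1, hx.2⟩
  refine (card_le_card h).trans (card_biUnion_le.trans (sum_le_sum fun v _ => ?_))
  exact card_image_le.trans (G.card_neighborFinset_eq_degree v).le

lemma card_crossing_filter_add_vol_le (G : SimpleGraph V) {S A : Finset V} (hSA : S ⊆ A) :
    ((crossing G S).filter fun x => x.2 ∈ A).card + vol G S ≤ vol G A := by
  have h : ((crossing G S).filter fun x => x.2 ∈ A) ⊆
      (A \ S).biUnion fun w => (G.neighborFinset w).image fun v => (v, w) := by
    rintro ⟨v, w⟩ hx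
    simp only [crossing, mem_filter, mem_product, mem_compl] at hx
    simpa using ⟨⟨hx.2, hx.1.1.2⟩, hx.1.2.symm⟩
  have h' : ((crossing G S).filter fun x => x.2 ∈ A).card ≤ ∑ w ∈ A \ S, G.degree w := by
    refine (card_le_card h).trans (card_biUnion_le.trans (sum_le_sum fun v _ => ?_))
    exact card_image_le.trans (G.card_neighborFinset_eq_degree v).le
  have := sum_sdiff (f := fun w => G.degree w) hSA
  simp only [vol]
  omega

lemma vol_univ (G : SimpleGraph V) : vol G univ = 2 * G.edgeFinset.card :=
  G.sum_degrees_eq_twice_card_edges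

lemma vol_mono (G : SimpleGraph V) {S A : Finset V} (h : S ⊆ A) : vol G S ≤ vol G A :=
  sum_le_sum_of_subset h

lemma vol_add_vol_compl (G : SimpleGraph V) (S : Finset V) :
    vol G S + vol G Sᶜ = 2 * G.edgeFinset.card := by
  rw [← vol_univ]
  exact sum_add_sum_compl S _

lemma vol_pos {G : SimpleGraph V} (hG : ∀ v, 0 < G.degree v) {S : Finset V}
    (hS : S.Nonempty) : 0 < vol G S :=
  sum_pos (fun v _ => hG v) hS

lemma mul_vol_le_card_crossing {G : SimpleGraph V} (hG : ∀ v, 0 < G.degree v) {φ : ℝ}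
    (h : ∀ T : Finset V, T.Nonempty → vol G T ≤ G.edgeFinset.card → φ < conduct G T)
    {T : Finset V} (hT : vol G T ≤ G.edgeFinset.card) :
    φ * vol G T ≤ (bdry G T).card := by
  rcases T.eq_empty_or_nonempty with rfl | hne
  · simp [vol]
  have h1 := h T hne hT
  have h2 : (0 : ℝ) < vol G T := by exact_mod_cast vol_pos hG hne
  rw [conduct, min_eq_left (by omega), lt_div_iff₀ h2] at h1
  exact h1.le

lemma sum_crossing_sub (G : SimpleGraph V) (S : Finset V) (f : V → ℝ) :
    ∑ x ∈ crossing G S, (f x.2 - f x.1) =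
      ∑ v ∈ S, ∑ w ∈ G.neighborFinset v, (f w - f v) := by
  have h1 : ∀ v, ∑ w ∈ G.neighborFinset v, (f w - f v) =
      ∑ w ∈ S, (if G.Adj v w then f w - f v else 0) +
        ∑ w ∈ Sᶜ, if G.Adj v w then f w - f v else 0 := by
    intro v
    rw [sum_add_sum_compl, ← sum_filter]
    congr 1
    ext w
    simp
  have h2 : ∑ v ∈ S, ∑ w ∈ S, (if G.Adj v w then f w - f v else 0) = 0 := by
    have h3 : ∑ v ∈ S, ∑ w ∈ S, (if G.Adj v w then f w - f v else 0) =
        -∑ v ∈ S, ∑ w ∈ S, (if G.Adj v w then f w - f v else 0) := by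
      conv_lhs => rw [sum_comm]
      simp only [← sum_neg_distrib]
      refine sum_congr rfl fun v _ => sum_congr rfl fun w _ => ?_
      by_cases hvw : G.Adj v w
      · simp [hvw, hvw.symm]
      · simp [hvw, G.adj_comm w v]
    linarith
  simp only [h1, sum_add_distrib, h2, zero_add]
  rw [crossing, sum_filter, sum_product]

lemma vol_sublevel_add_le {G : SimpleGraph V} {f : V → ℝ} {t δ : ℝ} (hδ : 0 < δ)
    (h : ∑ v ∈ sublevel f t, ∑ w ∈ G.neighborFinset v, (f w - f v) ≤
      δ * ((crossing G (sublevel f t)).card / 2)) :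
    (vol G (sublevel f t) : ℝ) + (crossing G (sublevel f t)).card / 2 ≤
      vol G (sublevel f (t + δ)) := by
  have hsub : sublevel f t ⊆ sublevel f (t + δ) := by
    intro v
    simp only [sublevel, mem_filter, mem_univ, true_and]
    intro hv
    linarith
  rw [← sum_crossing_sub] at h
  have h1 := card_crossing_filter_add_vol_le G hsub
  have h2 := card_filter_add_card_filter_not (s := crossing G (sublevel f t))
    (fun x => x.2 ∈ sublevel f (t + δ))
  have h3 : ((crossing G (sublevel f t)).filter
      fun x => ¬ x.2 ∈ sublevel f (t + δ)).card * δ ≤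
      ∑ x ∈ crossing G (sublevel f t), (f x.2 - f x.1) := by
    rw [← nsmul_eq_mul]
    refine (card_nsmul_le_sum _ (fun x => f x.2 - f x.1) _ fun x hx => ?_).trans
      (sum_le_sum_of_subset_of_nonneg (filter_subset _ _) fun x hx _ => ?_)
    · simp only [crossing, sublevel, mem_filter, mem_product, mem_univ, true_and, mem_compl] at hx
      linarith [hx.1.1.1]
    · simp only [crossing, sublevel, mem_filter, mem_product, mem_univ, true_and, mem_compl] at hx
      linarith [hx.1.1]
  have h4 : (((crossing G (sublevel f t)).filter
      fun x => ¬ x.2 ∈ sublevel f (t + δ)).card : ℝ) ≤ (crossing G (sublevel f t)).card / 2 := by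
    refine le_of_mul_le_mul_right (h3.trans (h.trans_eq (mul_comm _ _))) hδ
  have h1' : (((crossing G (sublevel f t)).filter fun x => x.2 ∈ sublevel f (t + δ)).card : ℝ) +
      vol G (sublevel f t) ≤ vol G (sublevel f (t + δ)) := by exact_mod_cast h1
  have h2' : (((crossing G (sublevel f t)).filter fun x => x.2 ∈ sublevel f (t + δ)).card : ℝ) +
      ((crossing G (sublevel f t)).filter fun x => ¬ x.2 ∈ sublevel f (t + δ)).card =
      (crossing G (sublevel f t)).card := by exact_mod_cast h2
  linarith

/-- Below half of the total volume, raising the level by a factor `1 + 2 β / φ` raises the volume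
of the sublevel set by a factor `1 + φ / 2`. -/
lemma pow_le_vol_sublevel {G : SimpleGraph V} {f : V → ℝ} {β φ : ℝ}
    (hG : ∀ v, 0 < G.degree v) (hβ : 0 < β) (hφ : 0 < φ)
    (hflow : ∀ v, ∑ w ∈ G.neighborFinset v, (f w - f v) ≤ β * (G.degree v * f v))
    (hexp : ∀ T : Finset V, vol G T ≤ G.edgeFinset.card → φ * vol G T ≤ (bdry G T).card)
    {t : ℝ} (ht : 0 < t) {u : V} (hu : f u ≤ t) (j : ℕ) :
    G.edgeFinset.card < vol G (sublevel f (t * (1 + 2 * β / φ) ^ j)) ∨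
      (1 + φ / 2) ^ j ≤ vol G (sublevel f (t * (1 + 2 * β / φ) ^ j)) := by
  induction j with
  | zero =>
    right
    have : 0 < vol G (sublevel f (t * (1 + 2 * β / φ) ^ 0)) :=
      vol_pos hG ⟨u, by simpa [sublevel] using hu⟩
    rw [pow_zero]
    exact_mod_cast this
  | succ j ih =>
    set s := t * (1 + 2 * β / φ) ^ j with hs
    have hs0 : 0 < s := by positivity
    have hδ : 0 < 2 * β * s / φ := by positivity
    have hs1 : t * (1 + 2 * β / φ) ^ (j + 1) = s + 2 * β * s / φ := by
      rw [hs, pow_succ]; ring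
    rw [hs1]
    by_cases hv : G.edgeFinset.card < vol G (sublevel f s)
    · left
      refine hv.trans_le (vol_mono G fun v => ?_)
      simp only [sublevel, mem_filter, mem_univ, true_and]
      intro hv
      linarith
    · right
      have ih := ih.resolve_left hv
      have hc : φ * vol G (sublevel f s) ≤ (crossing G (sublevel f s)).card :=
        (hexp _ (not_lt.1 hv)).trans (by exact_mod_cast card_bdry_le_card_crossing G _)
      have hmass : ∑ v ∈ sublevel f s, ∑ w ∈ G.neighborFinset v, (f w - f v) ≤
          β * (s * vol G (sublevel f s)) := by
        rw [vol, Nat.cast_sum, mul_sum, mul_sum]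
        refine sum_le_sum fun v hv => (hflow v).trans ?_
        have : f v ≤ s := by simpa [sublevel] using hv
        rw [mul_comm s]
        gcongr
      have := vol_sublevel_add_le (G := G) hδ (hmass.trans ?_)
      · refine le_trans ?_ this
        rw [pow_succ]
        nlinarith
      · calc β * (s * vol G (sublevel f s))
            = 2 * β * s / φ * (φ * vol G (sublevel f s) / 2) := by field_simp
          _ ≤ _ := by gcongr

/-- Above a level exceeded by at most half of the volume, a function of total mass one has mass
at most `2 β / φ` for each of the steps that exhaust this volume. -/
lemma sum_excess_le {G : SimpleGraph V} {f : V → ℝ} {β φ : ℝ}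
    (hG : ∀ v, 0 < G.degree v) (hβ : 0 < β) (hφ : 0 < φ)
    (hf : ∀ v, 0 ≤ f v) (hsum : ∑ v, G.degree v * f v = 1)
    (hflow : ∀ v, ∑ w ∈ G.neighborFinset v, (f w - f v) ≤ β * (G.degree v * f v))
    (hexp : ∀ T : Finset V, vol G T ≤ G.edgeFinset.card → φ * vol G T ≤ (bdry G T).card)
    (hφ2 : φ < 2) (j : ℕ) {s : ℝ} (hs : vol G (sublevel f s)ᶜ ≤ G.edgeFinset.card)
    (hj : vol G (sublevel f s)ᶜ * (1 - φ / 2) ^ j < 1) :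
    ∑ v, G.degree v * max (f v - s) 0 ≤ j * (2 * β / φ) := by
  have hzero : ∀ s, vol G (sublevel f s)ᶜ = 0 → ∑ v, G.degree v * max (f v - s) 0 = 0 := by
    intro s hs
    refine sum_eq_zero fun v _ => ?_
    have : v ∉ (sublevel f s)ᶜ := fun hv => (vol_pos hG ⟨v, hv⟩).ne' hs
    have : f v ≤ s := by simpa [sublevel] using this
    rw [max_eq_right (by linarith), mul_zero]
  induction j generalizing s with
  | zero =>
    have : vol G (sublevel f s)ᶜ = 0 := by
      have : vol G (sublevel f s)ᶜ < 1 := by exact_mod_cast (by simpa using hj)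
      omega
    simp [hzero s this]
  | succ j ih =>
    rcases Nat.eq_zero_or_pos (vol G (sublevel f s)ᶜ) with h0 | h0
    · rw [hzero s h0]
      positivity
    set H := (vol G (sublevel f s)ᶜ : ℝ) with hH
    have hH0 : 0 < H := by rw [hH]; exact_mod_cast h0
    have hδ : 0 < 2 * β / (φ * H) := by positivity
    have hc : φ * H ≤ (crossing G (sublevel f s)).card := by
      refine (hexp _ hs).trans ?_
      rw [bdry_compl]
      exact_mod_cast card_bdry_le_card_crossing G _
    have hmass : ∑ v ∈ sublevel f s, ∑ w ∈ G.neighborFinset v, (f w - f v) ≤ β := by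
      calc _ ≤ ∑ v ∈ sublevel f s, β * (G.degree v * f v) := sum_le_sum fun v _ => hflow v
        _ ≤ ∑ v, β * (G.degree v * f v) :=
          sum_le_sum_of_subset_of_nonneg (subset_univ _) fun v _ _ => by
            have := hf v
            positivity
        _ = β := by rw [← mul_sum, hsum, mul_one]
    have hstep := vol_sublevel_add_le (G := G) hδ (hmass.trans (by
      calc β = 2 * β / (φ * H) * (φ * H / 2) := by field_simp
        _ ≤ _ := by gcongr))
    have hv1 : (vol G (sublevel f s) : ℝ) + H = 2 * G.edgeFinset.card := by
      rw [hH]; exact_mod_cast vol_add_vol_compl G (sublevel f s)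
    have hv2 : (vol G (sublevel f (s + 2 * β / (φ * H))) : ℝ) +
        vol G (sublevel f (s + 2 * β / (φ * H)))ᶜ = 2 * G.edgeFinset.card := by
      exact_mod_cast vol_add_vol_compl G (sublevel f (s + 2 * β / (φ * H)))
    have hv3 : (vol G (sublevel f (s + 2 * β / (φ * H)))ᶜ : ℝ) ≤ H * (1 - φ / 2) := by
      linarith
    have hv4 : (vol G (sublevel f (s + 2 * β / (φ * H)))ᶜ : ℝ) ≤ H := by nlinarith
    have hrec := ih (s := s + 2 * β / (φ * H)) (by
        have : vol G (sublevel f (s + 2 * β / (φ * H)))ᶜ ≤ vol G (sublevel f s)ᶜ := by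
          exact Nat.cast_le.1 (hv4.trans_eq hH)
        exact this.trans hs) (by
        refine lt_of_le_of_lt ?_ hj
        rw [pow_succ', ← mul_assoc]
        have : 0 ≤ 1 - φ / 2 := by linarith
        gcongr)
    have hsplit : ∑ v, G.degree v * max (f v - s) 0 ≤
        ∑ v, G.degree v * max (f v - (s + 2 * β / (φ * H))) 0 +
          ∑ v ∈ (sublevel f s)ᶜ, G.degree v * (2 * β / (φ * H)) := by
      rw [← sum_add_sum_compl (sublevel f s)ᶜ (fun v => G.degree v * max (f v - s) 0),
        ← sum_add_sum_compl (sublevel f s)ᶜ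
          (fun v => G.degree v * max (f v - (s + 2 * β / (φ * H))) 0),
        add_right_comm, ← sum_add_distrib]
      refine add_le_add (sum_le_sum fun v _ => ?_) (sum_le_sum fun v hv => ?_)
      · rw [← mul_add]
        gcongr
        refine max_le ?_ (by positivity)
        linarith [le_max_left (f v - (s + 2 * β / (φ * H))) 0]
      · have : f v ≤ s := by simpa [sublevel] using hv
        refine mul_le_mul_of_nonneg_left ?_ (Nat.cast_nonneg _)
        rw [max_eq_right (by linarith)]
        exact le_max_right _ _
    have hlast : ∑ v ∈ (sublevel f s)ᶜ, G.degree v * (2 * β / (φ * H)) = 2 * β / φ := by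
      rw [← sum_mul, ← Nat.cast_sum]
      change H * _ = _
      field_simp
    push_cast
    linarith

lemma exists_pow_gt {m : ℕ} (hm : 2 ≤ m) {φ : ℝ} (hφ : 0 < φ) (hφ1 : φ ≤ 1) :
    ∃ N : ℕ, (m : ℝ) < (1 + φ / 2) ^ N ∧ N ≤ 6 * Real.logb 2 m / φ := by
  refine ⟨⌈2 / φ⌉₊ * (Nat.log 2 m + 1), ?_, ?_⟩
  · have h1 : (2 : ℝ) ≤ (1 + φ / 2) ^ ⌈2 / φ⌉₊ := by
      have := one_add_mul_le_pow (a := φ / 2) (by linarith) ⌈2 / φ⌉₊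
      have h2 := Nat.le_ceil (2 / φ)
      rw [div_le_iff₀ hφ] at h2
      linarith
    have h2 : (m : ℝ) < 2 ^ (Nat.log 2 m + 1) := by
      exact_mod_cast Nat.lt_pow_succ_log_self (by norm_num) m
    rw [pow_mul]
    exact h2.trans_le (by gcongr)
  · have h1 : (⌈2 / φ⌉₊ : ℝ) ≤ 3 / φ := by
      have := Nat.ceil_lt_add_one (a := 2 / φ) (by positivity)
      have h2 : 1 ≤ 1 / φ := by rwa [le_div_iff₀ hφ, one_mul]
      have : 3 / φ = 2 / φ + 1 / φ := by ring
      linarith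
    have h2 : (Nat.log 2 m : ℝ) ≤ Real.logb 2 m := by
      exact_mod_cast Real.natLog_le_logb m 2
    have h3 : (1 : ℝ) ≤ Nat.log 2 m := by
      exact_mod_cast Nat.log_pos (by norm_num) hm
    push_cast
    calc (⌈2 / φ⌉₊ : ℝ) * (Nat.log 2 m + 1) ≤ 3 / φ * (2 * Real.logb 2 m) := by
          gcongr
          linarith
      _ = _ := by ring

lemma lazyWalk_nonneg (G : SimpleGraph V) {q : V → ℝ} (hq : ∀ v, 0 ≤ q v) (v : V) :
    0 ≤ lazyWalk G q v := by
  have := hq v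
  have : 0 ≤ ∑ u ∈ G.neighborFinset v, q u / (2 * (G.degree u : ℝ)) :=
    sum_nonneg fun u _ => div_nonneg (hq u) (by positivity)
  rw [lazyWalk]
  positivity

lemma sum_lazyWalk {G : SimpleGraph V} (hG : ∀ v, 0 < G.degree v) (q : V → ℝ) :
    ∑ v, lazyWalk G q v = ∑ v, q v := by
  have h : ∑ v, ∑ u ∈ G.neighborFinset v, q u / (2 * (G.degree u : ℝ)) = ∑ u, q u / 2 := by
    rw [sum_comm' (t' := univ) (s' := fun u => G.neighborFinset u)
      (by simp [SimpleGraph.adj_comm])]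
    refine sum_congr rfl fun u _ => ?_
    have : (G.degree u : ℝ) ≠ 0 := by exact_mod_cast (hG u).ne'
    rw [sum_const, G.card_neighborFinset_eq_degree, nsmul_eq_mul]
    field_simp
  simp only [lazyWalk, sum_add_distrib, h]
  rw [← sum_add_distrib]
  simp

section PageRank

variable {G : SimpleGraph V} {α : ℝ} {p0 : V → ℝ}

lemma iterate_lazyWalk_nonneg (hp0 : ∀ v, 0 ≤ p0 v) (k : ℕ) (v : V) :
    0 ≤ (lazyWalk G)^[k] p0 v := by
  induction k generalizing v with
  | zero => exact hp0 v
  | succ k ih =>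
    rw [Function.iterate_succ_apply']
    exact lazyWalk_nonneg G ih v

lemma sum_iterate_lazyWalk (hG : ∀ v, 0 < G.degree v) (k : ℕ) :
    ∑ v, (lazyWalk G)^[k] p0 v = ∑ v, p0 v := by
  induction k with
  | zero => rfl
  | succ k ih => rw [Function.iterate_succ_apply', sum_lazyWalk hG, ih]

lemma summable_PR (hG : ∀ v, 0 < G.degree v) (hα : 0 < α) (hα1 : α ≤ 1)
    (hp0 : ∀ v, 0 ≤ p0 v) (v : V) :
    Summable fun k : ℕ => (1 - α) ^ k * (lazyWalk G)^[k] p0 v := by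
  refine Summable.of_nonneg_of_le
    (fun k => mul_nonneg (pow_nonneg (by linarith) k) (iterate_lazyWalk_nonneg hp0 k v))
    (fun k => ?_) ((summable_geometric_of_lt_one (by linarith) (by linarith : 1 - α < 1)).mul_right
      (∑ v, p0 v))
  refine mul_le_mul_of_nonneg_left ?_ (pow_nonneg (by linarith) k)
  rw [← sum_iterate_lazyWalk hG k]
  exact single_le_sum (fun w _ => iterate_lazyWalk_nonneg hp0 k w) (mem_univ v)

lemma PR_nonneg (hα : 0 < α) (hα1 : α ≤ 1) (hp0 : ∀ v, 0 ≤ p0 v) (v : V) :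
    0 ≤ PR G α p0 v :=
  mul_nonneg hα.le (tsum_nonneg fun k =>
    mul_nonneg (pow_nonneg (by linarith) k) (iterate_lazyWalk_nonneg hp0 k v))

lemma sum_PR (hG : ∀ v, 0 < G.degree v) (hα : 0 < α) (hα1 : α ≤ 1)
    (hp0 : ∀ v, 0 ≤ p0 v) : ∑ v, PR G α p0 v = ∑ v, p0 v := by
  simp only [PR]
  rw [← mul_sum, ← Summable.tsum_finsetSum fun v _ => summable_PR hG hα hα1 hp0 v]
  simp only [← mul_sum, sum_iterate_lazyWalk hG]
  rw [tsum_mul_right, tsum_geometric_of_lt_one (by linarith) (by linarith)]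
  rw [sub_sub_cancel, mul_inv_cancel_left₀ hα.ne']

lemma PR_eq (hG : ∀ v, 0 < G.degree v) (hα : 0 < α) (hα1 : α ≤ 1)
    (hp0 : ∀ v, 0 ≤ p0 v) (v : V) :
    PR G α p0 v = α * p0 v + (1 - α) * lazyWalk G (PR G α p0) v := by
  have hS := summable_PR hG hα hα1 hp0
  have h1 : ∀ k : ℕ, (1 - α) ^ (k + 1) * (lazyWalk G)^[k + 1] p0 v =
      (1 - α) * ((1 - α) ^ k * (lazyWalk G)^[k] p0 v / 2 + ∑ u ∈ G.neighborFinset v,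
        (1 - α) ^ k * (lazyWalk G)^[k] p0 u / (2 * (G.degree u : ℝ))) := by
    intro k
    rw [Function.iterate_succ_apply', lazyWalk, pow_succ', mul_assoc, mul_add, mul_sum]
    simp only [mul_div_assoc]
  conv_lhs => rw [PR, (hS v).tsum_eq_zero_add]
  simp only [h1]
  rw [tsum_mul_left, Summable.tsum_add ((hS v).div_const 2)
    (summable_sum fun u _ => (hS u).div_const _),
    Summable.tsum_finsetSum fun u _ => (hS u).div_const _]
  simp only [tsum_div_const, lazyWalk, PR, pow_zero, one_mul, Function.iterate_zero, id]
  simp only [mul_div_assoc, ← mul_sum]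
  ring

lemma sum_neighbor_PR_sub_le (hG : ∀ v, 0 < G.degree v) (hα : 0 < α) (hα1 : α ≤ 1 / 3)
    (hp0 : ∀ v, 0 ≤ p0 v) (v : V) :
    ∑ w ∈ G.neighborFinset v, (PR G α p0 w / G.degree w - PR G α p0 v / G.degree v) ≤
      3 * α * (G.degree v * (PR G α p0 v / G.degree v)) := by
  have hd : (G.degree v : ℝ) ≠ 0 := by exact_mod_cast (hG v).ne'
  have h1 := PR_eq hG hα (by linarith) hp0 v
  have h2 : ∑ w ∈ G.neighborFinset v, PR G α p0 w / (2 * (G.degree w : ℝ)) =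
      (∑ w ∈ G.neighborFinset v, PR G α p0 w / G.degree w) / 2 := by
    rw [sum_div]
    refine sum_congr rfl fun w _ => ?_
    ring
  have h3 := PR_nonneg (G := G) hα (by linarith) hp0 v
  have h4 := mul_nonneg hα.le (hp0 v)
  rw [sum_sub_distrib, sum_const, G.card_neighborFinset_eq_degree, nsmul_eq_mul,
    mul_div_cancel₀ _ hd]
  rw [lazyWalk, h2] at h1
  nlinarith [mul_nonneg hα.le h3]

end PageRank

lemma conduct_singleton_le_one (G : SimpleGraph V) (v : V) :
    vol G {v} ≤ G.edgeFinset.card ∧ conduct G {v} ≤ 1 := by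
  have h : vol G {v} ≤ G.edgeFinset.card := by
    rw [vol, sum_singleton, ← G.card_incidenceFinset_eq_degree]
    exact card_le_card (G.incidenceFinset_subset v)
  refine ⟨h, ?_⟩
  rw [conduct, min_eq_left (by omega)]
  refine div_le_one_of_le₀ ?_ (by positivity)
  exact_mod_cast (card_bdry_le_card_crossing G _).trans (card_crossing_le_vol G _)

theorem stmt16 :
    ∃ K : ℝ, 0 < K ∧
      ∀ (V : Type) [Fintype V], ∀ (G : SimpleGraph V) (m : ℕ),
        m = G.edgeFinset.card → 2 ≤ m →
        (∀ v : V, 0 < G.degree v) →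
        ∀ (α : ℝ), 0 < α → α ≤ 1 / 3 →
        ∀ (p0 : V → ℝ), (∀ v, 0 ≤ p0 v) → (∑ v, p0 v) = 1 →
        ∀ (γ : ℝ), 0 < γ → γ < 1 →
        ∀ (u : V),
          PR G α p0 u / (G.degree u : ℝ) ≤ (1 - γ) / (2 * (m : ℝ)) →
          ∃ T : Finset V, T.Nonempty ∧ vol G T ≤ m ∧
            conduct G T ≤ K * Real.sqrt (α * Real.logb 2 (m : ℝ) / γ) := by
  refine ⟨36, by norm_num, ?_⟩
  intro V _ G m hm hm2 hG α hα hα3 p0 hp0 hp1 γ hγ hγ1 u hu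
  by_contra! hcon
  subst hm
  set m := G.edgeFinset.card with hm
  set L := Real.logb 2 (m : ℝ) with hL
  set φ := 36 * Real.sqrt (α * L / γ) with hφdef
  have hmR : (2 : ℝ) ≤ m := by exact_mod_cast hm2
  have hL0 : 0 < L := Real.logb_pos (by norm_num) (by linarith)
  have hφ : 0 < φ := by positivity
  have hφsq : φ ^ 2 * γ = 1296 * (α * L) := by
    rw [hφdef, mul_pow, Real.sq_sqrt (by positivity)]
    field_simp
    norm_num
  obtain ⟨hu1, hu2⟩ := conduct_singleton_le_one G u
  have hφ1 : φ < 1 := (hcon {u} (singleton_nonempty u) hu1).trans_le hu2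
  have hexp : ∀ T : Finset V, vol G T ≤ G.edgeFinset.card → φ * vol G T ≤ (bdry G T).card :=
    fun T hT => mul_vol_le_card_crossing hG hcon hT
  set f : V → ℝ := fun v => PR G α p0 v / G.degree v with hf
  have hd : ∀ v, (G.degree v : ℝ) ≠ 0 := fun v => by exact_mod_cast (hG v).ne'
  have hf0 : ∀ v, 0 ≤ f v := fun v =>
    div_nonneg (PR_nonneg hα (by linarith) hp0 v) (by positivity)
  have hsum : ∑ v, G.degree v * f v = 1 := by
    rw [← hp1, ← sum_PR hG hα (by linarith) hp0]
    exact sum_congr rfl fun v _ => mul_div_cancel₀ _ (hd v)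
  have hflow := sum_neighbor_PR_sub_le hG hα hα3 hp0
  obtain ⟨N, hN, hN'⟩ := exists_pow_gt hm2 hφ hφ1.le
  have hx : N * (2 * (3 * α) / φ) ≤ γ / 36 := by
    calc N * (2 * (3 * α) / φ) ≤ 6 * L / φ * (2 * (3 * α) / φ) := by gcongr
      _ = 36 * (α * L) / φ ^ 2 := by ring
      _ = γ / 36 := by
        rw [div_eq_iff (by positivity)]
        linarith
  set t := (1 - γ) / (2 * (m : ℝ)) with ht
  have ht0 : 0 < t := div_pos (by linarith) (by linarith)
  set s := t * (1 + 2 * (3 * α) / φ) ^ N with hs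
  have hlow : m < vol G (sublevel f s) := by
    rcases pow_le_vol_sublevel hG (by positivity : 0 < 3 * α) hφ hflow hexp ht0 hu N with h | h
    · exact h
    · exact_mod_cast hN.trans_le h
  have hhigh : vol G (sublevel f s)ᶜ ≤ m := by
    have := vol_add_vol_compl G (sublevel f s)
    omega
  have hexc := sum_excess_le hG (by positivity : 0 < 3 * α) hφ hf0 hsum hflow hexp
    (by linarith) N hhigh (by
      calc (vol G (sublevel f s)ᶜ : ℝ) * (1 - φ / 2) ^ N ≤ m * (1 - φ / 2) ^ N := by
            have : 0 ≤ 1 - φ / 2 := by linarith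
            gcongr
        _ < (1 + φ / 2) ^ N * (1 - φ / 2) ^ N := by
            have : 0 < 1 - φ / 2 := by linarith
            gcongr
        _ = (1 - φ ^ 2 / 4) ^ N := by rw [← mul_pow]; ring
        _ ≤ 1 := pow_le_one₀ (by nlinarith) (by nlinarith))
  have hgrow : (1 + 2 * (3 * α) / φ) ^ N * (1 - γ / 36) ≤ 1 := by
    have h1 : (1 + 2 * (3 * α) / φ) ^ N ≤ Real.exp (γ / 36) := by
      calc (1 + 2 * (3 * α) / φ) ^ N ≤ Real.exp (2 * (3 * α) / φ) ^ N := by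
            gcongr
            linarith [Real.add_one_le_exp (2 * (3 * α) / φ)]
        _ = Real.exp (N * (2 * (3 * α) / φ)) := (Real.exp_nat_mul _ _).symm
        _ ≤ _ := Real.exp_le_exp.2 hx
    calc _ ≤ Real.exp (γ / 36) * Real.exp (-(γ / 36)) := by
          have : 0 ≤ 1 - γ / 36 := by linarith
          gcongr
          linarith [Real.add_one_le_exp (-(γ / 36))]
      _ = 1 := by rw [← Real.exp_add]; simp
  have htotal : (1 : ℝ) ≤ 2 * m * s + ∑ v, G.degree v * max (f v - s) 0 := by
    have hvol : ∑ v, (G.degree v : ℝ) = 2 * m := by exact_mod_cast vol_univ G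
    rw [← hvol, sum_mul, ← sum_add_distrib, ← hsum]
    refine sum_le_sum fun v _ => ?_
    rw [← mul_add]
    gcongr
    linarith [le_max_left (f v - s) 0]
  have hms : 2 * m * s = (1 - γ) * (1 + 2 * (3 * α) / φ) ^ N := by
    rw [hs, ht]
    field_simp
  rw [hms] at htotal
  have h1 : 1 - γ / 36 ≤ (1 - γ) * (1 + 2 * (3 * α) / φ) ^ N := by linarith
  nlinarith

end
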